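/- Let P be a p-subgroup of the finite group G with |P| = p^n. Then I_{≤P}(G) · J(Z(FG))^{(p^{n+1}−1)/(p−1)} = 0. -/

import Mathlib

set_option synthInstance.maxHeartbeats 1000000
set_option maxHeartbeats 1000000

open scoped Classical

/-- The class sum `K⁺ = ∑_{x ∈ K} x` of a conjugacy class `K` in the group algebra `FG`. -/
noncomputable def classSum (F : Type) [Field F] {G : Type} [Group G] [Fintype G]
    (K : ConjClasses G) : MonoidAlgebra F G :=
  ∑ x : G, if x ∈ K.carrier then MonoidAlgebra.single x (1 : F) else 0

/-- `P` is a defect group of the conjugacy class `K`: `P` is a Sylow `p`-subgroup of the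
centralizer of some element of `K`. -/
def IsClassDefectGroup {G : Type} [Group G] (p : ℕ) (P : Subgroup G) (K : ConjClasses G) : Prop :=
  ∃ x ∈ K.carrier, ∃ S : Sylow p ↥(Subgroup.centralizer {x}),
    P = Subgroup.map (Subgroup.centralizer {x}).subtype S.toSubgroup

/-- `I_P(G)`: the `F`-span of the class sums of conjugacy classes with defect group `P`. -/
noncomputable def classIdeal (F : Type) [Field F] {G : Type} [Group G] [Fintype G]
    (p : ℕ) (P : Subgroup G) : Submodule F (MonoidAlgebra F G) :=
  Submodule.span F {a | ∃ K : ConjClasses G, IsClassDefectGroup p P K ∧ a = classSum F K}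

/-- `I_{≤P}(G) = ∑_{Q ≤ P} I_Q(G)`. -/
noncomputable def classIdealLE (F : Type) [Field F] {G : Type} [Group G] [Fintype G]
    (p : ℕ) (P : Subgroup G) : Submodule F (MonoidAlgebra F G) :=
  ⨆ Q ≤ P, classIdeal F p Q

/-- `I_{<P}(G) = ∑_{Q < P} I_Q(G)`. -/
noncomputable def classIdealLT (F : Type) [Field F] {G : Type} [Group G] [Fintype G]
    (p : ℕ) (P : Subgroup G) : Submodule F (MonoidAlgebra F G) :=
  ⨆ Q < P, classIdeal F p Q

/-- The Jacobson radical `J(Z(FG))` of the center of the group algebra, viewed as an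
`F`-submodule of `FG`. -/
noncomputable def JZ (F : Type) [Field F] (G : Type) [Group G] [Fintype G] :
    Submodule F (MonoidAlgebra F G) :=
  Submodule.map (Subalgebra.center F (MonoidAlgebra F G)).val.toLinearMap
    ((Ideal.jacobson (⊥ : Ideal ↥(Subalgebra.center F (MonoidAlgebra F G)))).restrictScalars F)

section FixedPoints

theorem sum_eq_zero_of_fixedPoints {F : Type*} [Field F] {p : ℕ} [Fact p.Prime] [CharP F p]
    {D α : Type*} [Group D] [Finite D] [MulAction D α] [Fintype α] (hD : IsPGroup p D)
    (f : α → F) (hf : ∀ (d : D) (a : α), f (d • a) = f a)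
    (h0 : ∀ a ∈ MulAction.fixedPoints D α, f a = 0) : ∑ a, f a = 0 := by
  have := Fintype.ofFinite D
  rw [← (MulAction.selfEquivSigmaOrbits D α).symm.sum_comp, Fintype.sum_sigma]
  refine Finset.sum_eq_zero fun ω _ ↦ ?_
  have key : ∀ y : MulAction.orbit D ω.out,
      f ((MulAction.selfEquivSigmaOrbits D α).symm ⟨ω, y⟩) = f ω.out := by
    rintro ⟨_, d, rfl⟩
    exact hf d _
  rw [Finset.sum_congr rfl fun y _ ↦ key y, Finset.sum_const, Finset.card_univ,
    ← Nat.card_eq_fintype_card]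
  obtain ⟨k, hk⟩ := hD.card_orbit ω.out
  rw [hk]
  rcases Nat.eq_zero_or_pos k with rfl | hk0
  · have : ω.out ∈ MulAction.fixedPoints D α := by
      rw [MulAction.mem_fixedPoints_iff_card_orbit_eq_one, ← Nat.card_eq_fintype_card, hk, pow_zero]
    rw [h0 _ this, smul_zero]
  · rw [nsmul_eq_mul, Nat.cast_pow, CharP.cast_eq_zero, zero_pow hk0.ne', zero_mul]

theorem sum_eq_zero_of_conj_invariant {F : Type*} [Field F] {p : ℕ} [Fact p.Prime] [CharP F p]
    {G : Type*} [Group G] [Fintype G] {D : Subgroup G} (hD : IsPGroup p D) (f : G → F)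
    (hf : ∀ d ∈ D, ∀ y, f (d * y * d⁻¹) = f y)
    (h0 : ∀ y ∈ Subgroup.centralizer (D : Set G), f y = 0) : ∑ y, f y = 0 := by
  let act : MulAction D G :=
    { smul := fun d y ↦ d * y * (d : G)⁻¹
      one_smul := fun y ↦ show ((1 : D) : G) * y * ((1 : D) : G)⁻¹ = y by simp
      mul_smul := fun d e y ↦ show ((d * e : D) : G) * y * ((d * e : D) : G)⁻¹ =
        d * (e * y * (e : G)⁻¹) * (d : G)⁻¹ by simp [mul_assoc] }
  refine @sum_eq_zero_of_fixedPoints F _ p _ _ D G _ _ act _ hD f (fun d y ↦ hf d d.2 y) ?_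
  intro y hy
  refine h0 y (Subgroup.mem_centralizer_iff.mpr fun d hd ↦ ?_)
  have : d * y * d⁻¹ = y := hy ⟨d, hd⟩
  exact mul_inv_eq_iff_eq_mul.mp this

end FixedPoints

section GroupAlgebra

variable {F : Type*} [Field F] {G : Type*} [Group G] [Fintype G]

theorem coeff_mul_eq_sum (a b : MonoidAlgebra F G) (x : G) :
    (a * b).coeff x = ∑ y, a.coeff y * b.coeff (y⁻¹ * x) := by
  rw [MonoidAlgebra.coeff_mul_apply_left, Finsupp.sum_fintype _ _ (by simp)]

theorem mem_center_iff_coeff {a : MonoidAlgebra F G} :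
    a ∈ Subalgebra.center F (MonoidAlgebra F G) ↔
      ∀ g x, a.coeff (g * x * g⁻¹) = a.coeff x := by
  rw [Subalgebra.mem_center_iff]
  constructor
  · intro h g x
    have := congrArg (fun c ↦ c.coeff (g * x)) (h (MonoidAlgebra.single g 1))
    simpa using this.symm
  · intro h b
    ext x
    rw [coeff_mul_eq_sum, MonoidAlgebra.coeff_mul_apply_right, Finsupp.sum_fintype _ _ (by simp)]
    refine Finset.sum_congr rfl fun y _ ↦ ?_
    rw [mul_comm, ← h y (y⁻¹ * x)]
    simp

/-- The element of the group algebra with prescribed coefficients. -/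
noncomputable def groupAlgebraOfFun (f : G → F) : MonoidAlgebra F G :=
  .ofCoeff (Finsupp.equivFunOnFinite.symm f)

omit [Group G] in
@[simp]
theorem coeff_groupAlgebraOfFun (f : G → F) (x : G) : (groupAlgebraOfFun f).coeff x = f x := rfl

omit [Group G] in
theorem coeff_mapDomain_eq_sum {H : Type*} (f : G → H) (a : MonoidAlgebra F G) (y : H) :
    (a.mapDomain f).coeff y = ∑ x, if f x = y then a.coeff x else 0 := by
  rw [MonoidAlgebra.coeff_mapDomain, Finsupp.mapDomain, Finsupp.sum_fintype _ _ (by simp)]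
  simp [Finsupp.single_apply]

/-- If `j` is central and nilpotent, then the endomorphism `c ↦ j * a * c * x⁻¹` is nilpotent, so
its trace, the sum of the coefficients of `j * a` over the conjugates of `x`, vanishes. -/
theorem sum_coeff_conj_eq_zero {j a : MonoidAlgebra F G}
    (hj : j ∈ Subalgebra.center F (MonoidAlgebra F G)) (hn : IsNilpotent j) (x : G) :
    ∑ g, (j * a).coeff (g * x * g⁻¹) = 0 := by
  let b : Module.Basis G F (MonoidAlgebra F G) := .ofRepr (MonoidAlgebra.coeffLinearEquiv F)
  let T : Module.End F (MonoidAlgebra F G) :=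
    LinearMap.mulLeft F a * LinearMap.mulRight F (MonoidAlgebra.single x⁻¹ 1)
  have hN : IsNilpotent (LinearMap.mulLeft F j * T) := by
    refine Commute.isNilpotent_mul_right ?_ ((LinearMap.isNilpotent_mulLeft_iff F j).mpr hn)
    refine LinearMap.ext fun c ↦ ?_
    have hja : j * a = a * j := (Subalgebra.mem_center_iff.mp hj a).symm
    simp only [T, Module.End.mul_apply, LinearMap.mulLeft_apply, LinearMap.mulRight_apply]
    simp only [← mul_assoc, hja]
  have h := (LinearMap.isNilpotent_trace_of_isNilpotent hN).eq_zero
  rw [LinearMap.trace_eq_matrix_trace F b, Matrix.trace] at h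
  rw [← h]
  refine Finset.sum_congr rfl fun g _ ↦ ?_
  have hb : b g = MonoidAlgebra.single g 1 := rfl
  have hr : ∀ c, b.repr c = c.coeff := fun _ ↦ rfl
  rw [Matrix.diag_apply, LinearMap.toMatrix_apply, hb, hr]
  simp [T, ← mul_assoc]

end GroupAlgebra

section Vanishing

variable {F : Type*} [Field F] {G : Type*} [Group G] [Fintype G]

/-- The central elements of the group algebra whose coefficients vanish on the centralizers
of all `p`-subgroups in the family `𝓕`. -/
def centralVanishing (F : Type*) [Field F] {G : Type*} [Group G] (p : ℕ)
    (𝓕 : Subgroup G → Prop) : Submodule F (MonoidAlgebra F G) where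
  carrier := {b | b ∈ Subalgebra.center F (MonoidAlgebra F G) ∧ ∀ D : Subgroup G, IsPGroup p D →
    𝓕 D → ∀ x ∈ Subgroup.centralizer (D : Set G), b.coeff x = 0}
  add_mem' := fun ha hb ↦ ⟨add_mem ha.1 hb.1, fun D hD h x hx ↦ by
    simp [ha.2 D hD h x hx, hb.2 D hD h x hx]⟩
  zero_mem' := ⟨zero_mem _, by simp⟩
  smul_mem' := fun r b hb ↦ ⟨Subalgebra.smul_mem _ hb.1 r, fun D hD h x hx ↦ by
    simp [hb.2 D hD h x hx]⟩

/-- Restriction of coefficients to a subgroup. On the center, for the centralizer of a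
`p`-subgroup, this is the Brauer homomorphism. -/
noncomputable def restrictCoeff (F : Type*) [Field F] {G : Type*} [Group G] [Fintype G]
    (C : Subgroup G) : MonoidAlgebra F G →ₗ[F] MonoidAlgebra F C where
  toFun a := groupAlgebraOfFun fun x ↦ a.coeff x
  map_add' a b := by ext x; simp
  map_smul' r a := by ext x; simp

@[simp]
theorem coeff_restrictCoeff (C : Subgroup G) (a : MonoidAlgebra F G) (x : C) :
    (restrictCoeff F C a).coeff x = a.coeff x := rfl

theorem restrictCoeff_mem_center (C : Subgroup G) {a : MonoidAlgebra F G}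
    (ha : a ∈ Subalgebra.center F (MonoidAlgebra F G)) :
    restrictCoeff F C a ∈ Subalgebra.center F (MonoidAlgebra F C) :=
  mem_center_iff_coeff.mpr fun g x ↦ mem_center_iff_coeff.mp ha g x

variable {p : ℕ} [Fact p.Prime] [CharP F p]

theorem mul_mem_centralVanishing {𝓕 : Subgroup G → Prop} {b j : MonoidAlgebra F G}
    (hb : b ∈ centralVanishing F p 𝓕) (hj : j ∈ Subalgebra.center F (MonoidAlgebra F G)) :
    b * j ∈ centralVanishing F p 𝓕 := by
  refine ⟨mul_mem hb.1 hj, fun D hD h x hx ↦ ?_⟩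
  rw [coeff_mul_eq_sum]
  refine sum_eq_zero_of_conj_invariant hD _ (fun d hd y ↦ ?_) fun y hy ↦ ?_
  · have hdx : d * x * d⁻¹ = x := mul_inv_eq_iff_eq_mul.mpr (Subgroup.mem_centralizer_iff.mp hx d hd)
    rw [mem_center_iff_coeff.mp hb.1 d y, ← mem_center_iff_coeff.mp hj d (y⁻¹ * x)]
    congr 2
    conv_lhs => rw [← hdx]
    group
  · rw [hb.2 D hD h y hy, zero_mul]

theorem restrictCoeff_mul {P : Subgroup G} (hP : IsPGroup p P) {a b : MonoidAlgebra F G}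
    (ha : a ∈ Subalgebra.center F (MonoidAlgebra F G))
    (hb : b ∈ Subalgebra.center F (MonoidAlgebra F G)) :
    restrictCoeff F (Subgroup.centralizer (P : Set G)) (a * b) =
      restrictCoeff F (Subgroup.centralizer (P : Set G)) a *
        restrictCoeff F (Subgroup.centralizer (P : Set G)) b := by
  ext ⟨x, hx⟩
  rw [coeff_mul_eq_sum, coeff_restrictCoeff, coeff_mul_eq_sum, ← sub_eq_zero]
  have hsub : ∑ y : Subgroup.centralizer (P : Set G), a.coeff y * b.coeff ((y : G)⁻¹ * x) =
      ∑ y, if y ∈ Subgroup.centralizer (P : Set G) then a.coeff y * b.coeff (y⁻¹ * x) else 0 := by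
    rw [← Finset.sum_filter]
    exact (Finset.sum_subtype _ (by simp) fun y ↦ a.coeff y * b.coeff (y⁻¹ * x)).symm
  refine Eq.trans (congrArg _ hsub) ?_
  rw [← Finset.sum_sub_distrib]
  refine sum_eq_zero_of_conj_invariant hP _ (fun d hd y ↦ ?_) fun y hy ↦ ?_
  · have hdx : d * x * d⁻¹ = x := mul_inv_eq_iff_eq_mul.mpr (Subgroup.mem_centralizer_iff.mp hx d hd)
    have h1 : a.coeff (d * y * d⁻¹) * b.coeff ((d * y * d⁻¹)⁻¹ * x) =
        a.coeff y * b.coeff (y⁻¹ * x) := by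
      rw [mem_center_iff_coeff.mp ha d y, ← mem_center_iff_coeff.mp hb d (y⁻¹ * x)]
      congr 2
      conv_lhs => rw [← hdx]
      group
    by_cases hy : y ∈ Subgroup.centralizer (P : Set G)
    · have hdy : d * y * d⁻¹ = y :=
        mul_inv_eq_iff_eq_mul.mpr (Subgroup.mem_centralizer_iff.mp hy d hd)
      rw [hdy]
    · have hdy : d * y * d⁻¹ ∉ Subgroup.centralizer (P : Set G) := fun hc ↦ by
        have h2 := Subgroup.mem_centralizer_iff.mp hc d hd
        have h3 : d * y * d⁻¹ = y := by
          have h4 : d * y * d⁻¹ * d = d * (d * y * d⁻¹) := h2.symm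
          simp only [mul_assoc] at h4
          simpa [mul_assoc] using (mul_left_cancel h4).symm
        exact hy (h3 ▸ hc)
      rw [if_neg hdy, if_neg hy, h1]
  · rw [if_pos hy, sub_self]

theorem restrictCoeff_isNilpotent {P : Subgroup G} (hP : IsPGroup p P) {a : MonoidAlgebra F G}
    (ha : a ∈ Subalgebra.center F (MonoidAlgebra F G)) (hn : IsNilpotent a) :
    IsNilpotent (restrictCoeff F (Subgroup.centralizer (P : Set G)) a) := by
  have hpow : ∀ k, restrictCoeff F (Subgroup.centralizer (P : Set G)) (a ^ (k + 1)) =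
      restrictCoeff F (Subgroup.centralizer (P : Set G)) a ^ (k + 1) := by
    intro k
    induction k with
    | zero => simp
    | succ k ih => rw [pow_succ, restrictCoeff_mul hP (pow_mem ha _) ha, ih, ← pow_succ]
  obtain ⟨k, hk⟩ := hn
  exact ⟨k + 1, by rw [← hpow, pow_succ, hk, zero_mul, map_zero]⟩

/-- A central element supported on classes of `p`-defect zero is killed by every nilpotent
central element. -/
theorem mul_eq_zero_of_defect_zero {b j : MonoidAlgebra F G}
    (hb : b ∈ centralVanishing F p fun D ↦ ¬ D ≤ (⊥ : Subgroup G))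
    (hj : j ∈ Subalgebra.center F (MonoidAlgebra F G)) (hn : IsNilpotent j) : b * j = 0 := by
  have hcard : ∀ x, b.coeff x ≠ 0 → (Nat.card (Subgroup.centralizer {x}) : F) ≠ 0 := by
    intro x hx h0
    rw [CharP.cast_eq_zero_iff F p] at h0
    obtain ⟨⟨d, hd⟩, hord⟩ := exists_prime_orderOf_dvd_card' p h0
    rw [Subgroup.orderOf_mk] at hord
    have hdx : d * x = x * d := (Subgroup.mem_centralizer_singleton_iff.mp hd)
    refine hx (hb.2 (Subgroup.zpowers d) ?_ ?_ x ?_)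
    · exact IsPGroup.of_card (n := 1) (by rw [Nat.card_zpowers, hord, pow_one])
    · intro hle
      rw [Subgroup.zpowers_le, Subgroup.mem_bot] at hle
      rw [hle, orderOf_one] at hord
      exact (Fact.out : p.Prime).one_lt.ne hord
    · rw [Subgroup.mem_centralizer_iff]
      rintro _ ⟨k, rfl⟩
      exact (Commute.zpow_left hdx k).eq
  let a : MonoidAlgebra F G := groupAlgebraOfFun fun x ↦
    if x = (ConjClasses.mk x).out then b.coeff x / Nat.card (Subgroup.centralizer {x}) else 0
  have hba : b = ∑ g, MonoidAlgebra.single g⁻¹ 1 * a * MonoidAlgebra.single g 1 := by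
    ext x
    set r := (ConjClasses.mk x).out with hr
    have hmk : ConjClasses.mk r = ConjClasses.mk x := Quotient.out_eq _
    obtain ⟨g₀, hg₀⟩ := isConj_iff.mp (ConjClasses.mk_eq_mk_iff_isConj.mp hmk.symm)
    have hbr : b.coeff r = b.coeff x := by rw [← hg₀, mem_center_iff_coeff.mp hb.1]
    have hterm : ∀ g, (MonoidAlgebra.single (g * g₀)⁻¹ 1 * a *
        MonoidAlgebra.single (g * g₀) 1).coeff x =
        if g ∈ Subgroup.centralizer {r} then b.coeff x / Nat.card (Subgroup.centralizer {r})
        else 0 := by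
      intro g
      have hconj : g * g₀ * (x * (g * g₀)⁻¹) = g * r * g⁻¹ := by rw [← hg₀]; group
      have hmk' : ConjClasses.mk (g * r * g⁻¹) = ConjClasses.mk x := by
        rw [← hmk, ConjClasses.mk_eq_mk_iff_isConj]
        exact (isConj_iff.mpr ⟨g, rfl⟩).symm
      have hiff : g * r * g⁻¹ = r ↔ g ∈ Subgroup.centralizer {r} := by
        rw [Subgroup.mem_centralizer_singleton_iff, mul_inv_eq_iff_eq_mul]
      simp only [MonoidAlgebra.coeff_mul_single_apply, MonoidAlgebra.coeff_single_mul_apply,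
        inv_inv, one_mul, mul_one, hconj, a, coeff_groupAlgebraOfFun, hmk', ← hr, hiff]
      split_ifs with h
      · rw [hiff.mpr h, hbr]
      · rfl
    rw [MonoidAlgebra.coeff_sum, Finsupp.finsetSum_apply, ← Equiv.sum_comp (Equiv.mulRight g₀)]
    simp only [Equiv.coe_mulRight, hterm]
    rw [← Finset.sum_filter, Finset.sum_const, nsmul_eq_mul,
      ← Fintype.card_subtype, ← Nat.card_eq_fintype_card]
    by_cases hx : b.coeff x = 0
    · simp [hx]
    · exact (mul_div_cancel₀ _ (hcard r (hbr ▸ hx))).symm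
  rw [hba, Finset.sum_mul]
  ext x
  rw [MonoidAlgebra.coeff_sum, Finsupp.finsetSum_apply, MonoidAlgebra.coeff_zero,
    Finsupp.zero_apply, ← sum_coeff_conj_eq_zero (a := a) hj hn x]
  refine Finset.sum_congr rfl fun g _ ↦ ?_
  rw [mul_assoc _ _ j, Subalgebra.mem_center_iff.mp hj, ← mul_assoc, mul_assoc _ a j,
    Subalgebra.mem_center_iff.mp hj]
  simp only [MonoidAlgebra.coeff_mul_single_apply, MonoidAlgebra.coeff_single_mul_apply, inv_inv,
    one_mul, mul_one, mul_assoc g]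

end Vanishing

section Augmentation

theorem Ideal.pow_finrank_eq_bot_of_isNilpotent (F : Type*) {A : Type*} [Field F] [CommRing A]
    [Algebra F A] [FiniteDimensional F A] {I : Ideal A} (hI : IsNilpotent I) :
    I ^ Module.finrank F A = ⊥ := by
  have key : ∀ k, I ^ k = ⊥ ∨
      Module.finrank F ((I ^ k).restrictScalars F) + k ≤ Module.finrank F A := by
    intro k
    induction k with
    | zero => exact Or.inr (Submodule.finrank_le _)
    | succ k ih =>
      refine or_iff_not_imp_left.mpr fun hne ↦ ?_
      rcases ih with h | h
      · exact absurd (by rw [pow_succ, h, Ideal.bot_mul]) hne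
      · have hlt : I ^ (k + 1) < I ^ k := by
          refine lt_of_le_of_ne (Ideal.pow_le_pow_right k.le_succ) fun heq ↦ hne ?_
          have hstab : ∀ i, I ^ (k + i) = I ^ k := by
            intro i
            induction i with
            | zero => rfl
            | succ i ih => rw [← add_assoc, pow_succ, ih, ← pow_succ, heq]
          obtain ⟨n, hn⟩ := hI
          rw [heq, ← hstab n, pow_add, hn, mul_zero, Ideal.zero_eq_bot]
        have hlt' : (I ^ (k + 1)).restrictScalars F < (I ^ k).restrictScalars F := hlt
        have := Submodule.finrank_lt_finrank_of_lt hlt'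
        omega
  rcases key (Module.finrank F A) with h | h
  · exact h
  · have h0 : Module.finrank F ((I ^ Module.finrank F A).restrictScalars F) = 0 := by omega
    rw [Submodule.finrank_eq_zero, Submodule.restrictScalars_eq_bot_iff] at h0
    exact h0

/-- The span of the elements `z - 1` for `z` in the subgroup `Z`. -/
noncomputable def augmentationSpan (F : Type*) [Field F] {G : Type*} [Group G] (Z : Subgroup G) :
    Submodule F (MonoidAlgebra F G) :=
  Submodule.span F (Set.range fun z : Z ↦ MonoidAlgebra.single (z : G) 1 - 1)

variable {F : Type*} [Field F] {p : ℕ} [Fact p.Prime] [CharP F p]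

theorem single_sub_one_isNilpotent {A : Type*} [CommGroup A] (hA : IsPGroup p A) (z : A) :
    IsNilpotent (MonoidAlgebra.single z 1 - 1 : MonoidAlgebra F A) := by
  have : CharP (MonoidAlgebra F A) p := charP_of_injective_algebraMap
    (FaithfulSMul.algebraMap_injective F (MonoidAlgebra F A)) p
  obtain ⟨k, hk⟩ := hA z
  refine ⟨p ^ k, ?_⟩
  rw [sub_pow_char_pow, MonoidAlgebra.single_pow, hk, one_pow, one_pow, MonoidAlgebra.one_def,
    sub_self]

theorem Submodule.restrictScalars_ideal_pow_le {A : Type*} [CommRing A] [Algebra F A]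
    (I : Ideal A) {k : ℕ} (hk : k ≠ 0) :
    (I.restrictScalars F) ^ k ≤ (I ^ k).restrictScalars F := by
  induction k, Nat.one_le_iff_ne_zero.mpr hk using Nat.le_induction with
  | base => simp
  | succ k _ ih =>
    rw [pow_succ, Submodule.mul_le]
    intro a ha b hb
    rw [Submodule.restrictScalars_mem, pow_succ]
    exact Ideal.mul_mem_mul (ih (by omega) ha) hb

theorem augmentationSpan_pow_card {G : Type*} [Group G] [Finite G] {Z : Subgroup G}
    (hZ : IsPGroup p Z) (hc : Z ≤ Subgroup.center G) :
    augmentationSpan F Z ^ Nat.card Z = ⊥ := by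
  let _ : CommGroup Z :=
    { (inferInstance : Group Z) with
      mul_comm := fun a b ↦ Subtype.ext ((Subgroup.mem_center_iff.mp (hc b.2)) a) }
  let A := MonoidAlgebra F Z
  let I : Ideal A := Ideal.span (Set.range fun z : Z ↦ MonoidAlgebra.single z 1 - 1)
  let φ : A →ₐ[F] MonoidAlgebra F G := MonoidAlgebra.mapDomainAlgHom F F Z.subtype
  let b : Module.Basis Z F A := .ofRepr (MonoidAlgebra.coeffLinearEquiv F)
  have : FiniteDimensional F A := b.finiteDimensional_of_finite
  have hrank : Module.finrank F A = Nat.card Z := Module.finrank_eq_nat_card_basis b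
  have hI : IsNilpotent I := by
    have hle : I ≤ nilradical A := by
      rw [Ideal.span_le]
      rintro _ ⟨z, rfl⟩
      exact single_sub_one_isNilpotent hZ z
    have : IsNoetherianRing A := isNoetherian_of_tower F inferInstance
    obtain ⟨n, hn⟩ := IsNoetherianRing.isNilpotent_nilradical A
    exact ⟨n, le_bot_iff.mp ((Ideal.pow_right_mono hle n).trans hn.le)⟩
  have hle : augmentationSpan F Z ≤ (I.restrictScalars F).map φ.toLinearMap := by
    rw [augmentationSpan, Submodule.span_le]
    rintro _ ⟨z, rfl⟩
    refine ⟨MonoidAlgebra.single z 1 - 1, Ideal.subset_span ⟨z, rfl⟩, ?_⟩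
    change φ (MonoidAlgebra.single z 1 - 1) = _
    rw [map_sub, map_one]
    exact congrArg (· - 1) MonoidAlgebra.mapDomain_single
  rw [eq_bot_iff]
  calc augmentationSpan F Z ^ Nat.card Z ≤ (I.restrictScalars F).map φ.toLinearMap ^ Nat.card Z :=
        pow_le_pow_left' hle _
    _ = ((I.restrictScalars F) ^ Nat.card Z).map φ.toLinearMap := (Submodule.map_pow ..).symm
    _ ≤ ((I ^ Nat.card Z).restrictScalars F).map φ.toLinearMap :=
        Submodule.map_mono (Submodule.restrictScalars_ideal_pow_le I Nat.card_pos.ne')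
    _ = ⊥ := by
      rw [← hrank, Ideal.pow_finrank_eq_bot_of_isNilpotent F hI]
      simp

end Augmentation

section CentralSubgroup

variable {F : Type*} [Field F] {p : ℕ} [Fact p.Prime] [CharP F p] {G : Type*} [Group G] [Fintype G]

theorem mapDomain_mem_center {H : Type*} [Group H] [Finite H] {f : G →* H}
    (hf : Function.Surjective f) {a : MonoidAlgebra F G}
    (ha : a ∈ Subalgebra.center F (MonoidAlgebra F G)) :
    a.mapDomain f ∈ Subalgebra.center F (MonoidAlgebra F H) := by
  have := Fintype.ofFinite H
  rw [mem_center_iff_coeff]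
  intro h y
  obtain ⟨g, rfl⟩ := hf h
  rw [coeff_mapDomain_eq_sum, coeff_mapDomain_eq_sum, ← Equiv.sum_comp (MulAut.conj g).toEquiv]
  refine Finset.sum_congr rfl fun x _ ↦ ?_
  simp [mem_center_iff_coeff.mp ha]

theorem mapDomain_mem_centralVanishing {Z : Subgroup G} [Z.Normal] (hZ : IsPGroup p Z)
    {b : MonoidAlgebra F G} (hb : b ∈ centralVanishing F p fun D ↦ ¬ D ≤ Z) :
    b.mapDomain (QuotientGroup.mk' Z) ∈
      centralVanishing F p fun D ↦ ¬ D ≤ (⊥ : Subgroup (G ⧸ Z)) := by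
  refine ⟨mapDomain_mem_center (QuotientGroup.mk'_surjective Z) hb.1, fun D hD hne h hh ↦ ?_⟩
  have hD' : IsPGroup p (D.comap (QuotientGroup.mk' Z)) :=
    hD.comap_of_ker_isPGroup _ (by rwa [QuotientGroup.ker_mk'])
  rw [coeff_mapDomain_eq_sum]
  refine sum_eq_zero_of_conj_invariant hD' _ (fun d hd y ↦ ?_) fun y hy ↦ ?_
  · have hdh := mul_inv_eq_iff_eq_mul.mpr (Subgroup.mem_centralizer_iff.mp hh _ hd)
    have hiff : QuotientGroup.mk' Z (d * y * d⁻¹) = h ↔ QuotientGroup.mk' Z y = h := by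
      rw [map_mul, map_mul, map_inv]
      nth_rewrite 1 [← hdh]
      rw [mul_left_inj, mul_right_inj]
    by_cases hy : QuotientGroup.mk' Z y = h
    · rw [if_pos hy, if_pos (hiff.mpr hy), mem_center_iff_coeff.mp hb.1]
    · rw [if_neg hy, if_neg (mt hiff.mp hy)]
  · rw [hb.2 _ hD' (fun hle ↦ hne fun q hq ↦ ?_) y hy, ite_self]
    obtain ⟨g, rfl⟩ := QuotientGroup.mk'_surjective Z q
    exact (QuotientGroup.eq_one_iff g).mpr (hle hq)

theorem exists_pPrime_exponent (p : ℕ) [Fact p.Prime] (G : Type*) [Group G] [Finite G] :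
    ∃ m, ¬ p ∣ m ∧ ∀ x : G, IsPGroup p (Subgroup.zpowers (x ^ m)) := by
  obtain ⟨k, m, hm, hcard⟩ := Nat.exists_eq_pow_mul_and_not_dvd (Nat.card_pos (α := G)).ne' p
    (Fact.out : p.Prime).ne_one
  refine ⟨m, hm, fun x ↦ ?_⟩
  rw [IsPGroup.iff_card, Nat.card_zpowers]
  have hdvd : orderOf (x ^ m) ∣ p ^ k :=
    orderOf_dvd_of_pow_eq_one (by rw [← pow_mul, mul_comm, ← hcard, pow_card_eq_one'])
  obtain ⟨i, -, hi⟩ := (Nat.dvd_prime_pow Fact.out).mp hdvd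
  exact ⟨i, hi⟩

omit [CharP F p] in
theorem mem_augmentationSpan_mul {Z : Subgroup G} [Z.Normal] (hZ : IsPGroup p Z)
    (hc : Z ≤ Subgroup.center G) {b : MonoidAlgebra F G}
    (hb : b ∈ centralVanishing F p fun D ↦ ¬ D ≤ Z)
    (h0 : b.mapDomain (QuotientGroup.mk' Z) = 0) :
    b ∈ augmentationSpan F Z * centralVanishing F p fun D ↦ ¬ D ≤ Z := by
  obtain ⟨m, hm, hpow⟩ := exists_pPrime_exponent p G
  have hcomm : ∀ z ∈ Z, ∀ x, Commute z x := fun z hz x ↦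
    (Subgroup.mem_center_iff.mp (hc hz) x).symm
  let c : Z → MonoidAlgebra F G := fun z ↦
    groupAlgebraOfFun fun y ↦ if y ^ m = 1 then b.coeff (y * z) else 0
  have hcmem : ∀ z, c z ∈ centralVanishing F p fun D ↦ ¬ D ≤ Z := by
    intro z
    refine ⟨mem_center_iff_coeff.mpr fun g x ↦ ?_, fun D hD hne x hx ↦ ?_⟩
    · have h1 : g * x * g⁻¹ * z = g * (x * z) * g⁻¹ := by
        rw [mul_assoc _ g⁻¹, ← (hcomm z z.2 g⁻¹).eq]
        group
      simp only [c, coeff_groupAlgebraOfFun, conj_pow, h1, mem_center_iff_coeff.mp hb.1]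
      simp only [mul_inv_eq_one, mul_eq_left]
    · have hxz : x * z ∈ Subgroup.centralizer (D : Set G) :=
        mul_mem hx (Subgroup.mem_centralizer_iff.mpr fun d _ ↦ (hcomm z z.2 d).eq.symm)
      simp [c, hb.2 D hD hne _ hxz]
  have hsum : ∑ z, c z = 0 := by
    ext y
    rw [MonoidAlgebra.coeff_sum, Finsupp.finsetSum_apply]
    have h1 := congrArg (fun a ↦ a.coeff (QuotientGroup.mk' Z y)) h0
    simp only [coeff_mapDomain_eq_sum] at h1
    rw [← Equiv.sum_comp (Equiv.mulLeft y)] at h1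
    simp only [Equiv.coe_mulLeft, map_mul, mul_eq_left, QuotientGroup.mk'_apply,
      QuotientGroup.eq_one_iff] at h1
    rw [← Finset.sum_filter,
      Finset.sum_subtype (p := (· ∈ Z)) _ (by simp) fun x ↦ b.coeff (y * x)] at h1
    by_cases hy : y ^ m = 1
    · simpa [c, hy] using h1
    · simp [c, hy]
  have hdecomp : b = ∑ z : Z, MonoidAlgebra.single (z : G) 1 * c z := by
    ext x
    rw [MonoidAlgebra.coeff_sum, Finsupp.finsetSum_apply]
    have hterm : ∀ z : Z, (MonoidAlgebra.single (z : G) 1 * c z).coeff x =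
        if x ^ m = (z : G) ^ m then b.coeff x else 0 := by
      intro z
      have h1 : (z : G)⁻¹ * x * z = x := by
        rw [mul_assoc, ← (hcomm z z.2 x).eq, inv_mul_cancel_left]
      have h2 : ((z : G)⁻¹ * x) ^ m = 1 ↔ x ^ m = (z : G) ^ m := by
        rw [(hcomm _ (inv_mem z.2) x).mul_pow, inv_pow, inv_mul_eq_one, eq_comm]
      simp [c, h1, h2]
    by_cases hx : b.coeff x = 0
    · simp [hterm, hx]
    have hxm : x ^ m ∈ Z := by
      by_contra hxm
      refine hx (hb.2 _ (hpow x) (fun hle ↦ hxm (hle (Subgroup.mem_zpowers _))) x ?_)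
      rw [Subgroup.mem_centralizer_iff]
      rintro _ ⟨k, rfl⟩
      exact ((Commute.refl x).pow_left m).zpow_left k
    let e := hZ.powEquiv' hm
    have he : ∀ z : Z, x ^ m = (z : G) ^ m ↔ z = e.symm ⟨x ^ m, hxm⟩ := by
      intro z
      rw [Equiv.eq_symm_apply, eq_comm, Subtype.ext_iff]
      rfl
    simp only [hterm, he]
    simp
  have hdecomp' : b = ∑ z : Z, (MonoidAlgebra.single (z : G) 1 - 1) * c z := by
    simp only [sub_mul, one_mul, Finset.sum_sub_distrib, hsum, sub_zero]
    exact hdecomp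
  rw [hdecomp']
  exact Submodule.sum_mem _ fun z _ ↦
    Submodule.mul_mem_mul (Submodule.subset_span ⟨z, rfl⟩) (hcmem z)

/-- Multiplying by a nilpotent central element moves the central elements with central defect
group `Z` into the augmentation ideal of `Z`. -/
theorem mul_mem_augmentationSpan_mul {Z : Subgroup G} (hZ : IsPGroup p Z)
    (hc : Z ≤ Subgroup.center G) {b j : MonoidAlgebra F G}
    (hb : b ∈ centralVanishing F p fun D ↦ ¬ D ≤ Z)
    (hj : j ∈ Subalgebra.center F (MonoidAlgebra F G)) (hn : IsNilpotent j) :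
    b * j ∈ augmentationSpan F Z * centralVanishing F p fun D ↦ ¬ D ≤ Z := by
  have hnormal : Z.Normal :=
    ⟨fun z hz g ↦ by
      rwa [Subgroup.mem_center_iff.mp (hc hz) g, mul_inv_cancel_right]⟩
  refine mem_augmentationSpan_mul hZ hc (mul_mem_centralVanishing hb hj) ?_
  let π := MonoidAlgebra.mapDomainAlgHom F F (QuotientGroup.mk' Z)
  change π (b * j) = 0
  rw [map_mul]
  have := Fintype.ofFinite (G ⧸ Z)
  exact mul_eq_zero_of_defect_zero (p := p) (mapDomain_mem_centralVanishing hZ hb)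
    (mapDomain_mem_center (QuotientGroup.mk'_surjective Z) hj) (hn.map π)

end CentralSubgroup

section BrauerStep

variable {F : Type*} [Field F] {p : ℕ} [Fact p.Prime] [CharP F p] {G : Type*} [Group G] [Fintype G]

omit [CharP F p] in
theorem restrictCoeff_mem_centralVanishing {n : ℕ} {P : Subgroup G} (hP : Nat.card P = p ^ n)
    {b : MonoidAlgebra F G}
    (hb : b ∈ centralVanishing F p fun D : Subgroup G ↦ Nat.card D = p ^ (n + 1)) :
    restrictCoeff F (Subgroup.centralizer (P : Set G)) b ∈ centralVanishing F p
      fun D ↦ ¬ D ≤ P.subgroupOf (Subgroup.centralizer (P : Set G)) := by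
  refine ⟨restrictCoeff_mem_center _ hb.1, fun D hD hne x hx ↦ ?_⟩
  set D' := D.map (Subgroup.centralizer (P : Set G)).subtype with hD'
  have hDn : D' ≤ Subgroup.normalizer (P : Set G) :=
    (Subgroup.map_subtype_le D).trans (Subgroup.centralizer_le_normalizer (P : Set G))
  have hE : IsPGroup p ↥(D' ⊔ P) :=
    IsPGroup.to_sup_of_normal_right' (hD.map _) (IsPGroup.of_card hP) hDn
  have hlt : P < D' ⊔ P := by
    refine lt_of_le_of_ne le_sup_right fun heq ↦ hne fun d hd ↦ ?_
    exact Subgroup.mem_subgroupOf.mpr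
      (right_eq_sup.mp heq (Subgroup.mem_map_of_mem _ hd))
  obtain ⟨i, hi⟩ := hE.exists_card_eq
  have hcard : p ^ (n + 1) ≤ Nat.card ↥(D' ⊔ P) := by
    have h1 : Nat.card P < Nat.card ↥(D' ⊔ P) :=
      lt_of_le_of_ne (Subgroup.card_le_of_le hlt.le) fun h ↦
        hlt.ne (Subgroup.eq_of_le_of_card_ge hlt.le h.ge)
    rw [hP, hi, Nat.pow_lt_pow_iff_right (Fact.out : p.Prime).one_lt] at h1
    rw [hi]
    exact Nat.pow_le_pow_right (Fact.out : p.Prime).pos h1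
  obtain ⟨E, hEcard⟩ := Sylow.exists_subgroup_card_pow_prime_of_le_card Fact.out hE hcard
  have hEcard' : Nat.card (E.map (D' ⊔ P).subtype) = p ^ (n + 1) := by
    rw [Subgroup.card_map_of_injective (Subgroup.subtype_injective _), hEcard]
  refine hb.2 _ (IsPGroup.of_card hEcard') hEcard' x ?_
  have hle : D' ⊔ P ≤ Subgroup.centralizer {(x : G)} := by
    refine sup_le ?_ fun g hg ↦ ?_
    · rintro _ ⟨d, hd, rfl⟩
      exact Subgroup.mem_centralizer_singleton_iff.mpr
        (congrArg Subtype.val (Subgroup.mem_centralizer_iff.mp hx d hd))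
    · exact Subgroup.mem_centralizer_singleton_iff.mpr (Subgroup.mem_centralizer_iff.mp x.2 g hg)
  exact Subgroup.mem_centralizer_iff.mpr fun g hg ↦
    Subgroup.mem_centralizer_singleton_iff.mp (hle (Subgroup.map_subtype_le E hg))

theorem centralVanishing_mul_pow_le {J : Submodule F (MonoidAlgebra F G)}
    (hJ : ∀ j ∈ J, j ∈ Subalgebra.center F (MonoidAlgebra F G) ∧ IsNilpotent j) (n : ℕ) :
    (centralVanishing F p fun D : Subgroup G ↦ Nat.card D = p ^ (n + 1)) * J ^ p ^ n ≤
      centralVanishing F p fun D : Subgroup G ↦ Nat.card D = p ^ n := by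
  set W := centralVanishing F p fun D : Subgroup G ↦ Nat.card D = p ^ (n + 1) with hW
  have hrestrict : ∀ P : Subgroup G, Nat.card P = p ^ n → ∀ i, W * J ^ i ≤ W ⊓
      (augmentationSpan F (P.subgroupOf (Subgroup.centralizer (P : Set G))) ^ i *
        centralVanishing F p fun D ↦ ¬ D ≤ P.subgroupOf (Subgroup.centralizer (P : Set G))).comap
          (restrictCoeff F (Subgroup.centralizer (P : Set G))) := by
    intro P hP i
    have hPp : IsPGroup p P := IsPGroup.of_card hP
    set Z := P.subgroupOf (Subgroup.centralizer (P : Set G)) with hZdef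
    have hZ : IsPGroup p Z := hPp.comap_of_injective _ (Subgroup.subtype_injective _)
    have hc : Z ≤ Subgroup.center _ := fun z hz ↦ Subgroup.mem_center_iff.mpr fun g ↦
      Subtype.ext (Subgroup.mem_centralizer_iff.mp g.2 z hz).symm
    induction i with
    | zero =>
      rw [pow_zero, pow_zero, mul_one, one_mul]
      exact le_inf le_rfl fun b hb ↦ restrictCoeff_mem_centralVanishing hP hb
    | succ i ih =>
      rw [pow_succ, ← mul_assoc]
      refine (mul_le_mul' ih le_rfl).trans (Submodule.mul_le.mpr fun b hb j hj ↦ ?_)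
      obtain ⟨hjc, hjn⟩ := hJ j hj
      refine ⟨mul_mem_centralVanishing hb.1 hjc, ?_⟩
      rw [SetLike.mem_coe, Submodule.mem_comap, restrictCoeff_mul hPp hb.1.1 hjc, pow_succ, mul_assoc]
      refine Submodule.mul_induction_on (Submodule.mem_comap.mp hb.2) (fun a ha u hu ↦ ?_)
        fun a a' ha ha' ↦ by rw [add_mul]; exact add_mem ha ha'
      rw [mul_assoc]
      exact Submodule.mul_mem_mul ha (mul_mem_augmentationSpan_mul hZ hc hu
        (restrictCoeff_mem_center _ hjc) (restrictCoeff_isNilpotent hPp hjc hjn))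
  intro b hb
  have hmulW : ∀ i, W * J ^ i ≤ W := by
    intro i
    induction i with
    | zero => simp
    | succ i ih =>
      rw [pow_succ, ← mul_assoc]
      exact (mul_le_mul' ih le_rfl).trans
        (Submodule.mul_le.mpr fun b hb j hj ↦ mul_mem_centralVanishing hb (hJ j hj).1)
  have hbW : b ∈ W := hmulW _ hb
  refine ⟨hbW.1, fun P hPp hP x hx ↦ ?_⟩
  have hZ : IsPGroup p (P.subgroupOf (Subgroup.centralizer (P : Set G))) :=
    hPp.comap_of_injective _ (Subgroup.subtype_injective _)
  have hc : P.subgroupOf (Subgroup.centralizer (P : Set G)) ≤ Subgroup.center _ :=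
    fun z hz ↦ Subgroup.mem_center_iff.mpr fun g ↦
      Subtype.ext (Subgroup.mem_centralizer_iff.mp g.2 z hz).symm
  have hcard : Nat.card (P.subgroupOf (Subgroup.centralizer (P : Set G))) ≤ p ^ n :=
    hP ▸ Nat.card_le_card_of_injective
      (fun z ↦ (⟨z, z.2⟩ : P)) fun a b h ↦
        Subtype.ext (Subtype.ext (congrArg (fun w : P ↦ (w : G)) h))
  have h0 := (hrestrict P hP _ hb).2
  rw [← Nat.add_sub_cancel' hcard, pow_add, augmentationSpan_pow_card hZ hc, Submodule.bot_mul,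
    Submodule.bot_mul] at h0
  exact congrArg (fun a ↦ a.coeff ⟨x, hx⟩) ((Submodule.mem_bot F).mp h0)

omit [Fact p.Prime] [CharP F p] [Fintype G] in
theorem centralVanishing_card_eq_one :
    (centralVanishing F p fun D : Subgroup G ↦ Nat.card D = p ^ 0) = ⊥ := by
  rw [eq_bot_iff]
  intro b hb
  rw [Submodule.mem_bot]
  ext x
  exact hb.2 ⊥ IsPGroup.of_bot (by simp) x (Subgroup.mem_centralizer_iff.mpr (by simp))

theorem centralVanishing_mul_pow_eq_bot {J : Submodule F (MonoidAlgebra F G)}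
    (hJ : ∀ j ∈ J, j ∈ Subalgebra.center F (MonoidAlgebra F G) ∧ IsNilpotent j) (n : ℕ) :
    (centralVanishing F p fun D : Subgroup G ↦ Nat.card D = p ^ n) *
      J ^ (∑ k ∈ Finset.range n, p ^ k) = ⊥ := by
  induction n with
  | zero => rw [centralVanishing_card_eq_one, Submodule.bot_mul]
  | succ n ih =>
    rw [Finset.sum_range_succ, add_comm (∑ k ∈ Finset.range n, p ^ k) (p ^ n), pow_add J (p ^ n),
      ← mul_assoc, eq_bot_iff, ← ih]
    exact mul_le_mul' (centralVanishing_mul_pow_le hJ n) le_rfl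

end BrauerStep

section ClassSums

theorem mem_JZ {F : Type} [Field F] {G : Type} [Group G] [Fintype G] {j : MonoidAlgebra F G}
    (hj : j ∈ JZ F G) : j ∈ Subalgebra.center F (MonoidAlgebra F G) ∧ IsNilpotent j := by
  obtain ⟨z, hz, rfl⟩ := hj
  refine ⟨z.2, ?_⟩
  have : FiniteDimensional F (MonoidAlgebra F G) :=
    (Module.Basis.ofRepr (MonoidAlgebra.coeffLinearEquiv F) :
      Module.Basis G F (MonoidAlgebra F G)).finiteDimensional_of_finite
  have : IsArtinianRing (Subalgebra.center F (MonoidAlgebra F G)) := IsArtinianRing.of_finite F _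
  obtain ⟨n, hn⟩ := IsArtinianRing.isNilpotent_jacobson_bot
    (R := Subalgebra.center F (MonoidAlgebra F G))
  have hzn : IsNilpotent z := ⟨n, by simpa [hn] using Ideal.pow_mem_pow hz n⟩
  exact hzn.map (Subalgebra.center F (MonoidAlgebra F G)).val

theorem coeff_classSum {F : Type} [Field F] {G : Type} [Group G] [Fintype G] (K : ConjClasses G)
    (x : G) : (classSum F K).coeff x = if x ∈ K.carrier then 1 else 0 := by
  rw [classSum, MonoidAlgebra.coeff_sum, Finsupp.finsetSum_apply, Finset.sum_eq_single x]
  · split_ifs <;> simp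
  · intro y _ hy
    split_ifs <;> simp [hy]
  · simp

theorem IsClassDefectGroup.card_dvd {G : Type} [Group G] [Finite G] {p : ℕ} [Fact p.Prime]
    {Q : Subgroup G} {K : ConjClasses G} (hQ : IsClassDefectGroup p Q K) {D : Subgroup G} {m : ℕ}
    (hD : Nat.card D = p ^ m) {x : G} (hx : x ∈ Subgroup.centralizer (D : Set G))
    (hxK : x ∈ K.carrier) : p ^ m ∣ Nat.card Q := by
  obtain ⟨y, hy, S, rfl⟩ := hQ
  rw [ConjClasses.mem_carrier_iff_mk_eq] at hxK hy
  obtain ⟨g, rfl⟩ := isConj_iff.mp (ConjClasses.mk_eq_mk_iff_isConj.mp (hxK.trans hy.symm))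
  rw [Subgroup.card_map_of_injective (Subgroup.subtype_injective _)]
  refine S.pow_dvd_card_of_pow_dvd_card ?_
  rw [← hD, ← Subgroup.card_map_of_injective (f := (MulAut.conj g).toMonoidHom)
    (MulAut.conj g).injective]
  refine Subgroup.card_dvd_of_le ?_
  rintro _ ⟨d, hd, rfl⟩
  rw [Subgroup.mem_centralizer_singleton_iff]
  have hdx : d * x = x * d := Subgroup.mem_centralizer_iff.mp hx d hd
  simp [mul_assoc, hdx, ← mul_assoc d x]

theorem classIdealLE_le_centralVanishing {F : Type} [Field F] {G : Type} [Group G] [Fintype G]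
    {p : ℕ} [Fact p.Prime] {P : Subgroup G} {n : ℕ} (hP : Nat.card P = p ^ n) :
    classIdealLE F p P ≤
      centralVanishing F p fun D : Subgroup G ↦ Nat.card D = p ^ (n + 1) := by
  refine iSup₂_le fun Q hQ ↦ Submodule.span_le.mpr ?_
  rintro _ ⟨K, hK, rfl⟩
  refine ⟨mem_center_iff_coeff.mpr fun g x ↦ ?_, fun D _ hD x hx ↦ ?_⟩
  · have hconj : ConjClasses.mk (g * x * g⁻¹) = ConjClasses.mk x :=
      ConjClasses.mk_eq_mk_iff_isConj.mpr (isConj_iff.mpr ⟨g, rfl⟩).symm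
    simp only [coeff_classSum, ConjClasses.mem_carrier_iff_mk_eq, hconj]
  · rw [coeff_classSum, if_neg]
    intro hxK
    have h1 := (hK.card_dvd hD hx hxK).trans (Subgroup.card_dvd_of_le hQ)
    rw [hP, Nat.pow_dvd_pow_iff_le_right (Fact.out : p.Prime).one_lt] at h1
    omega

end ClassSums

/-- If `P` is a `p`-subgroup of `G` with `|P| = p^n`, then
`I_{≤P}(G) · J(Z(FG))^((p^(n+1)-1)/(p-1)) = 0`. -/
theorem stmt2 (F : Type) [Field F] [IsAlgClosed F] (G : Type) [Group G] [Fintype G]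
    (p : ℕ) [Fact p.Prime] [CharP F p]
    (P : Subgroup G) (hP : IsPGroup p P) (n : ℕ) (hcard : Fintype.card ↥P = p ^ n) :
    classIdealLE F p P * (JZ F G) ^ ((p ^ (n + 1) - 1) / (p - 1)) = ⊥ := by
  rw [← Nat.geomSum_eq (Fact.out : p.Prime).two_le, eq_bot_iff,
    ← centralVanishing_mul_pow_eq_bot (p := p) (J := JZ F G) (fun j hj ↦ mem_JZ hj) (n + 1)]
  exact mul_le_mul'
    (classIdealLE_le_centralVanishing (by rw [Nat.card_eq_fintype_card]; convert hcard)) le_rfl
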